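/- arXiv:2011.09009 — 7 statements merged into one kernel-verified Lean document; each statement's English description precedes it below -/
import Mathlib

section
/- Let A be a commutative ring and let S be the localization of R at the multiplicative set generated by the elements ξ_i − ξ_j for i ≠ j; the 𝔖-action on R extends to S. Then extension and contraction along the canonical map A → S, namely 𝔞 ↦ 𝔞S and 𝔟 ↦ (preimage of 𝔟 in A), are mutually inverse bijections between the set of ideals of A and the set of 𝔖-stable ideals of S. -/
open MvPolynomial

noncomputable section

/-- A permutation of `ℕ` is finitely supported if it moves only finitely many elements.
The infinite symmetric group `𝔖` consists of the finitely supported permutations. -/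
def FinSupp (σ : Equiv.Perm ℕ) : Prop := {x : ℕ | σ x ≠ x}.Finite

/-- The multiplicative set of `R = A[ξ_1, ξ_2, …]` generated by the elements
`ξ_i − ξ_j` for `i ≠ j`. -/
def distMonoid (A : Type*) [CommRing A] : Submonoid (MvPolynomial ℕ A) :=
  Submonoid.closure {g | ∃ i j : ℕ, i ≠ j ∧ g = X i - X j}

/-- `S`, the localization of `R` at the multiplicative set generated by the `ξ_i − ξ_j`. -/
abbrev SLoc (A : Type*) [CommRing A] := Localization (distMonoid A)

/-- The canonical map `A → S`. -/
def iota (A : Type*) [CommRing A] : A →+* SLoc A :=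
  (algebraMap (MvPolynomial ℕ A) (SLoc A)).comp (C : A →+* MvPolynomial ℕ A)

/-- An ideal `𝔟` of `S` is `𝔖`-stable if it is preserved by the (unique) extension to `S` of
each renaming automorphism `σ` of `R` with `σ ∈ 𝔖`: any ring endomorphism `φ` of `S`
compatible with `rename σ` on `R` carries `𝔟` into itself. -/
def SStableLoc (A : Type*) [CommRing A] (b : Ideal (SLoc A)) : Prop :=
  ∀ σ : Equiv.Perm ℕ, FinSupp σ →
    ∀ φ : SLoc A →+* SLoc A,
      (∀ r : MvPolynomial ℕ A,
        φ (algebraMap (MvPolynomial ℕ A) (SLoc A) r) =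
          algebraMap (MvPolynomial ℕ A) (SLoc A) (rename ⇑σ r)) →
      ∀ x ∈ b, φ x ∈ b

section Contraction

variable {A : Type*} [CommRing A]

/-- The substitution `ξ_i ↦ t ^ i` sends products of differences of variables to polynomials
that are monic up to a unit. -/
lemma exists_unit_mul_monic_of_mem_distMonoid {s : MvPolynomial ℕ A} (hs : s ∈ distMonoid A) :
    ∃ u : Aˣ, (Polynomial.C (u : A) *
      aeval (fun i : ℕ => (Polynomial.X : Polynomial A) ^ i) s).Monic := by
  nontriviality A
  induction hs using Submonoid.closure_induction with
  | mem s hs =>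
    have key : ∀ i j : ℕ, i < j →
        ((Polynomial.X : Polynomial A) ^ j - Polynomial.X ^ i).Monic := fun i j h => by
      refine (Polynomial.monic_X_pow j).sub_of_left ?_
      rw [Polynomial.degree_X_pow, Polynomial.degree_X_pow]
      exact_mod_cast h
    obtain ⟨i, j, hij, rfl⟩ := hs
    rcases hij.lt_or_gt with h | h
    · exact ⟨-1, by simpa using key i j h⟩
    · exact ⟨1, by simpa using key j i h⟩
  | one => exact ⟨1, by simp⟩
  | mul x y _ _ hx hy =>
    obtain ⟨u, hu⟩ := hx
    obtain ⟨v, hv⟩ := hy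
    refine ⟨u * v, ?_⟩
    convert hu.mul hv using 1
    simp only [Units.val_mul, map_mul]
    ring

lemma mem_of_mul_C_mem_map_C {a : Ideal A} {s : MvPolynomial ℕ A} (hs : s ∈ distMonoid A)
    {x : A} (h : s * C x ∈ a.map (C : A →+* MvPolynomial ℕ A)) : x ∈ a := by
  obtain ⟨u, hu⟩ := exists_unit_mul_monic_of_mem_distMonoid hs
  set f : MvPolynomial ℕ A →ₐ[A] Polynomial A := aeval (fun i : ℕ => Polynomial.X ^ i)
  have h1 : f (s * C x) ∈ a.map (Polynomial.C : A →+* Polynomial A) := by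
    have h2 := Ideal.mem_map_of_mem (f : MvPolynomial ℕ A →+* Polynomial A) h
    rw [Ideal.map_map] at h2
    have hC : (f : MvPolynomial ℕ A →+* Polynomial A).comp C = Polynomial.C := by
      ext1 r
      simp [f, Polynomial.algebraMap_eq]
    rwa [hC] at h2
  have h3 := Ideal.mem_map_C_iff.1 (Ideal.mul_mem_left _ (Polynomial.C (u : A)) h1)
    (Polynomial.C (u : A) * f s).natDegree
  have hfx : f (C x) = Polynomial.C x := by simp [f, Polynomial.algebraMap_eq]
  rwa [map_mul, ← mul_assoc, hfx, Polynomial.coeff_mul_C, hu.coeff_natDegree, one_mul] at h3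

lemma comap_iota_map_iota (a : Ideal A) : (a.map (iota A)).comap (iota A) = a := by
  refine le_antisymm (fun x hx => ?_) Ideal.le_comap_map
  rw [Ideal.mem_comap, iota, ← Ideal.map_map, RingHom.comp_apply,
    IsLocalization.algebraMap_mem_map_algebraMap_iff (distMonoid A)] at hx
  obtain ⟨s, hs, h⟩ := hx
  exact mem_of_mul_C_mem_map_C hs h

lemma sStableLoc_map_iota (a : Ideal A) : SStableLoc A (a.map (iota A)) := by
  intro σ _ φ hφ x hx
  have h : φ.comp (iota A) = iota A := by
    ext r
    simp only [iota, RingHom.comp_apply, hφ, rename_C]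
  have h2 := Ideal.mem_map_of_mem φ hx
  rwa [Ideal.map_map, h] at h2

end Contraction

section Extension

variable {A : Type*} [CommRing A]

/-- A polynomial in the `ξ_j` viewed as a polynomial in `ξ_i`, with coefficients in the other
variables. -/
def asPolynomialIn (A : Type*) [CommRing A] (i : ℕ) :
    MvPolynomial ℕ A →ₐ[A] Polynomial (MvPolynomial ℕ A) :=
  aeval fun j => if j = i then Polynomial.X else Polynomial.C (X j)

lemma eval_asPolynomialIn (i : ℕ) (q p : MvPolynomial ℕ A) :
    (asPolynomialIn A i p).eval q = aeval (fun j => if j = i then q else X j) p := by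
  induction p using MvPolynomial.induction_on with
  | C a => simp [asPolynomialIn, Polynomial.algebraMap_apply, MvPolynomial.algebraMap_eq]
  | add p q hp hq => simp [hp, hq]
  | mul_X p j hp =>
    rw [map_mul, Polynomial.eval_mul, hp, map_mul]
    congr 1
    simp only [asPolynomialIn, aeval_X]
    split_ifs <;> simp

lemma eval_X_asPolynomialIn_eq_rename {i y : ℕ} {p : MvPolynomial ℕ A} (hy : y ∉ p.vars) :
    (asPolynomialIn A i p).eval (X y) = rename (Equiv.swap i y) p := by
  rw [eval_asPolynomialIn, rename_eq_aeval]
  refine eval₂Hom_congr' rfl (fun j hj _ => ?_) rfl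
  have hjy : j ≠ y := fun h => hy (h ▸ hj)
  rw [Function.comp_apply]
  split_ifs with h
  · rw [h, Equiv.swap_apply_left]
  · rw [Equiv.swap_apply_of_ne_of_ne h hjy]

lemma coeff_asPolynomialIn_mem_supported {i : ℕ} {s : Set ℕ} {p : MvPolynomial ℕ A}
    (hp : p ∈ supported A (insert i s)) (k : ℕ) :
    (asPolynomialIn A i p).coeff k ∈ supported A s := by
  rw [supported] at hp
  induction hp using Algebra.adjoin_induction generalizing k with
  | mem x hx =>
    obtain ⟨j, hj, rfl⟩ := hx
    simp only [asPolynomialIn, aeval_X]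
    split_ifs with h
    · rw [Polynomial.coeff_X]
      split_ifs
      exacts [one_mem _, zero_mem _]
    · rw [Polynomial.coeff_C]
      split_ifs
      · exact Algebra.subset_adjoin ⟨j, hj.resolve_left h, rfl⟩
      · exact zero_mem _
  | algebraMap r =>
    rw [AlgHom.commutes, Polynomial.algebraMap_apply, Polynomial.coeff_C]
    split_ifs
    exacts [Subalgebra.algebraMap_mem _ r, zero_mem _]
  | add x y _ _ hx hy =>
    rw [map_add, Polynomial.coeff_add]
    exact add_mem (hx k) (hy k)
  | mul x y _ _ hx hy =>
    rw [map_mul, Polynomial.coeff_mul]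
    exact sum_mem fun c _ => mul_mem (hx c.1) (hy c.2)

lemma finSupp_swap (i j : ℕ) : FinSupp (Equiv.swap i j) :=
  (Set.toFinite {i, j}).subset fun x hx => by
    by_contra h
    simp only [Set.mem_insert_iff, Set.mem_singleton_iff, not_or] at h
    exact hx (Equiv.swap_apply_of_ne_of_ne h.1 h.2)

lemma coeff_asPolynomialIn_mem {J : Ideal (MvPolynomial ℕ A)}
    (hst : ∀ i j, ∀ p ∈ J, rename (Equiv.swap i j) p ∈ J)
    (hsat : ∀ s ∈ distMonoid A, ∀ p, s * p ∈ J → p ∈ J)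
    {p : MvPolynomial ℕ A} (hp : p ∈ J) (i k : ℕ) : (asPolynomialIn A i p).coeff k ∈ J := by
  set q := asPolynomialIn A i p
  by_cases hk : k < q.natDegree + 1
  swap
  · rw [Polynomial.coeff_eq_zero_of_natDegree_lt (by omega)]
    exact zero_mem _
  obtain ⟨M, hM⟩ : ∃ M, ∀ j ∈ p.vars, j < M :=
    ⟨p.vars.sup id + 1, fun j hj => Nat.lt_succ_of_le (Finset.le_sup (f := id) hj)⟩
  let v : Fin (q.natDegree + 1) → MvPolynomial ℕ A := fun t => X (M + t)
  let c : Fin (q.natDegree + 1) → MvPolynomial ℕ A := fun t => q.coeff t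
  have hV : ∀ t, (Matrix.vandermonde v).mulVec c t ∈ J := fun t => by
    have h : (Matrix.vandermonde v).mulVec c t = q.eval (X (M + t)) := by
      rw [Polynomial.eval_eq_sum_range, ← Fin.sum_univ_eq_sum_range
        (fun e => q.coeff e * (X (M + t) : MvPolynomial ℕ A) ^ e)]
      simp only [Matrix.mulVec, dotProduct, Matrix.vandermonde_apply, v, c, mul_comm]
    rw [h, eval_X_asPolynomialIn_eq_rename fun h => by have := hM _ h; omega]
    exact hst _ _ _ hp
  refine hsat (Matrix.vandermonde v).det ?_ _ ?_
  · rw [Matrix.det_vandermonde]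
    refine Submonoid.prod_mem _ fun a _ => Submonoid.prod_mem _ fun b hb => ?_
    refine Submonoid.subset_closure ⟨M + b, M + a, ?_, rfl⟩
    have := Fin.lt_def.1 (Finset.mem_Ioi.1 hb)
    omega
  · have h : (Matrix.vandermonde v).det * q.coeff k =
        (Matrix.vandermonde v).adjugate.mulVec ((Matrix.vandermonde v).mulVec c) ⟨k, hk⟩ := by
      rw [Matrix.mulVec_mulVec, Matrix.adjugate_mul, Matrix.smul_mulVec, Matrix.one_mulVec]
      rfl
    rw [h, Matrix.mulVec, dotProduct]
    exact Ideal.sum_mem _ fun t _ => Ideal.mul_mem_left _ _ (hV t)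

/-- An ideal of `A[ξ_1, ξ_2, …]` which is symmetric and saturated with respect to the differences
of variables is extended from `A`. -/
lemma le_map_C_comap_C {J : Ideal (MvPolynomial ℕ A)}
    (hst : ∀ i j, ∀ p ∈ J, rename (Equiv.swap i j) p ∈ J)
    (hsat : ∀ s ∈ distMonoid A, ∀ p, s * p ∈ J → p ∈ J) :
    J ≤ (J.comap (C : A →+* MvPolynomial ℕ A)).map C := by
  have key : ∀ s : Finset ℕ, ∀ p ∈ supported A (s : Set ℕ), p ∈ J →
      p ∈ (J.comap (C : A →+* MvPolynomial ℕ A)).map C := by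
    intro s
    induction s using Finset.induction_on with
    | empty =>
      intro p hs hp
      rw [Finset.coe_empty, supported_empty, Algebra.mem_bot] at hs
      obtain ⟨a, rfl⟩ := hs
      exact Ideal.mem_map_of_mem _ hp
    | insert i s _ ih =>
      intro p hs hp
      rw [Finset.coe_insert] at hs
      have h : p = (asPolynomialIn A i p).eval (X i) := by
        rw [eval_asPolynomialIn]
        conv_lhs => rw [← aeval_X_left_apply p]
        congr 2
        funext j
        split_ifs with h
        exacts [h ▸ rfl, rfl]
      rw [h, Polynomial.eval_eq_sum_range]
      exact Ideal.sum_mem _ fun k _ => Ideal.mul_mem_right _ _ <|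
        ih _ (coeff_asPolynomialIn_mem_supported hs k) (coeff_asPolynomialIn_mem hst hsat hp i k)
  exact fun p hp => key p.vars p (mem_supported_vars p) hp

lemma distMonoid_le_comap_rename (σ : Equiv.Perm ℕ) :
    distMonoid A ≤ (distMonoid A).comap (rename σ : MvPolynomial ℕ A →ₐ[A] _).toRingHom := by
  refine Submonoid.closure_le.2 ?_
  rintro _ ⟨i, j, hij, rfl⟩
  exact Submonoid.subset_closure ⟨σ i, σ j, σ.injective.ne hij, by simp⟩

lemma map_iota_comap_iota {b : Ideal (SLoc A)} (hb : SStableLoc A b) :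
    (b.comap (iota A)).map (iota A) = b := by
  refine le_antisymm Ideal.map_comap_le ?_
  have hst : ∀ i j, ∀ p ∈ b.comap (algebraMap (MvPolynomial ℕ A) (SLoc A)),
      rename (Equiv.swap i j) p ∈ b.comap (algebraMap (MvPolynomial ℕ A) (SLoc A)) := by
    intro i j p hp
    have hφ := IsLocalization.map_eq (S := SLoc A) (Q := SLoc A)
      (distMonoid_le_comap_rename (A := A) (Equiv.swap i j))
    have h := hb _ (finSupp_swap i j) _ hφ _ hp
    rwa [hφ] at h
  have hsat : ∀ s ∈ distMonoid A, ∀ p,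
      s * p ∈ b.comap (algebraMap (MvPolynomial ℕ A) (SLoc A)) →
      p ∈ b.comap (algebraMap (MvPolynomial ℕ A) (SLoc A)) := by
    intro s hs p h
    rw [Ideal.mem_comap, map_mul] at h
    exact (Ideal.unit_mul_mem_iff_mem _ (IsLocalization.map_units (SLoc A) ⟨s, hs⟩)).1 h
  conv_lhs => rw [← IsLocalization.map_under (distMonoid A) (SLoc A) b]
  refine (Ideal.map_mono (le_map_C_comap_C hst hsat)).trans ?_
  rw [Ideal.map_map, Ideal.comap_comap]
  exact le_rfl

end Extension

/-- Extension and contraction along `A → S` are mutually inverse bijections between the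
ideals of `A` and the `𝔖`-stable ideals of `S`. -/
theorem statement2 (A : Type*) [CommRing A] :
    (∀ a : Ideal A,
      SStableLoc A (a.map (iota A)) ∧ (a.map (iota A)).comap (iota A) = a) ∧
    (∀ b : Ideal (SLoc A), SStableLoc A b → (b.comap (iota A)).map (iota A) = b) := by
  exact ⟨fun a => ⟨sStableLoc_map_iota a, comap_iota_map_iota a⟩, fun _ => map_iota_comap_iota⟩
end
end

section
/- Let T and Y be topological spaces, and let the group of all permutations of ℕ act on T × Y^ℕ by σ · (t, x) = (t, x ∘ σ⁻¹). If Z ⊆ T × Y^ℕ is closed in the product topology and is stable under every finitely supported permutation of ℕ, then Z is stable under every permutation of ℕ. (This is the statement that a Π-closed 𝔖-stable set of K-points of 𝔛 is stable under the big symmetric group 𝔖^big = Aut(ℕ).) -/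
/-- Every permutation agrees on a given finite set with a finitely supported permutation. -/
theorem Equiv.Perm.exists_finite_support_eqOn {α : Type*} (ρ : Equiv.Perm α) (s : Finset α) :
    ∃ τ : Equiv.Perm α, {x | τ x ≠ x}.Finite ∧ ∀ i ∈ s, τ i = ρ i := by
  classical
  induction s using Finset.induction_on with
  | empty => exact ⟨1, by simp, by simp⟩
  | insert a s ha ih =>
    obtain ⟨τ, hfin, hτ⟩ := ih
    refine ⟨Equiv.swap (τ a) (ρ a) * τ, ?_, ?_⟩
    · refine (hfin.union (Set.toFinite {τ a, ρ a})).subset fun x hx => ?_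
      by_contra hn
      simp only [Set.mem_union, Set.mem_ofPred_eq, Set.mem_insert_iff, Set.mem_singleton_iff,
        not_or, not_not] at hn
      obtain ⟨h₁, h₂, h₃⟩ := hn
      exact hx (by rw [Equiv.Perm.mul_apply, h₁, Equiv.swap_apply_of_ne_of_ne h₂ h₃])
    · intro i hi
      rcases Finset.mem_insert.1 hi with rfl | hi
      · simp
      · have hia : i ≠ a := fun h => ha (h ▸ hi)
        rw [Equiv.Perm.mul_apply, Equiv.swap_apply_of_ne_of_ne (τ.injective.ne hia), hτ i hi]
        rw [hτ i hi]
        exact ρ.injective.ne hia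

/-- A `Π`-closed set of points that is stable under the infinite symmetric group `𝔖` (of
finitely supported permutations of `ℕ`) is stable under the big symmetric group
`𝔖^big = Aut(ℕ)`: if `Z ⊆ T × Y^ℕ` is closed in the product topology and stable under the
action `σ · (t, x) = (t, x ∘ σ⁻¹)` of every finitely supported permutation `σ` of `ℕ`, then
`Z` is stable under this action of every permutation of `ℕ`. -/
theorem statement4 (T Y : Type*) [TopologicalSpace T] [TopologicalSpace Y]
    (Z : Set (T × (ℕ → Y))) (hZ : IsClosed Z)
    (hstab : ∀ σ : Equiv.Perm ℕ, {x : ℕ | σ x ≠ x}.Finite →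
      ∀ p ∈ Z, (p.1, p.2 ∘ ⇑σ.symm) ∈ Z) :
    ∀ σ : Equiv.Perm ℕ, ∀ p ∈ Z, (p.1, p.2 ∘ ⇑σ.symm) ∈ Z := by
  intro σ p hp
  choose τ hfin hτ using fun n => Equiv.Perm.exists_finite_support_eqOn σ.symm (Finset.range n)
  have hlim : Filter.Tendsto (fun n => (p.1, p.2 ∘ ⇑(τ n))) Filter.atTop
      (nhds (p.1, p.2 ∘ ⇑σ.symm)) := by
    refine tendsto_const_nhds.prodMk_nhds (tendsto_pi_nhds.2 fun i => ?_)
    refine tendsto_const_nhds.congr' ?_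
    filter_upwards [Filter.eventually_gt_atTop i] with n hn
    simp [hτ n i (Finset.mem_range.2 hn)]
  refine hZ.mem_of_tendsto hlim (Filter.Eventually.of_forall fun n => ?_)
  refine hstab (τ n).symm ((hfin n).subset fun x hx h => hx ?_) p hp
  rw [Equiv.symm_apply_eq, h]
end

section
/- Let A be a commutative ring, let 𝒵 be a C2 subset of 𝒳, and let f : λ → μ be a map of ∞-compositions. Then α_f(𝒵_μ) ⊆ 𝒵_λ. -/
open MvPolynomial

noncomputable section

/-- An `∞`-composition: a finite index set `idx ⊆ ℕ` together with weights
`w : ℕ → ℕ∞` which are positive exactly on `idx` (and zero off `idx`), at least one of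
which is `∞`. -/
structure IComp : Type where
  idx : Finset ℕ
  w : ℕ → ℕ∞
  pos : ∀ i ∈ idx, 0 < w i
  zero : ∀ i ∉ idx, w i = 0
  inf : ∃ i ∈ idx, w i = ⊤

/-- A function `f : ⟨λ⟩ → ⟨μ⟩` is a map of generalized compositions `λ → μ` if
`Σ_{i ∈ f⁻¹(j)} λ_i ≤ μ_j` for all `j ∈ ⟨μ⟩`. -/
def IsCompMap (l m : IComp) (f : {i // i ∈ l.idx} → {j // j ∈ m.idx}) : Prop :=
  ∀ j : {j // j ∈ m.idx}, (∑ i : {i // i ∈ l.idx}, if f i = j then l.w i.1 else 0) ≤ m.w j.1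

/-- `f` is a principal surjection `λ ↠ μ` if `Σ_{i ∈ f⁻¹(j)} λ_i = μ_j` for all `j`. -/
def IsPrincSurj (l m : IComp) (f : {i // i ∈ l.idx} → {j // j ∈ m.idx}) : Prop :=
  ∀ j : {j // j ∈ m.idx}, (∑ i : {i // i ∈ l.idx}, if f i = j then l.w i.1 else 0) = m.w j.1

variable (A : Type) [CommRing A]

/-- The affine space `𝒳_λ = Spec A[t_i : i ∈ ⟨λ⟩]`. -/
abbrev XSp (l : IComp) := PrimeSpectrum (MvPolynomial {i // i ∈ l.idx} A)

/-- For a function `f : ⟨λ⟩ → ⟨μ⟩`, the morphism `α_f : 𝒳_μ → 𝒳_λ` induced by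
`t_i ↦ t_{f(i)}`. -/
def alphaC {l m : IComp} (f : {i // i ∈ l.idx} → {j // j ∈ m.idx}) :
    XSp A m → XSp A l :=
  PrimeSpectrum.comap (rename f).toRingHom

/-- A subset `𝒵` of `𝒳`: a rule assigning to each `∞`-composition `λ` a subset
`𝒵_λ ⊆ 𝒳_λ`. -/
def SubsetX := (l : IComp) → Set (XSp A l)

/-- `𝒵` is C1 if `α_f⁻¹(𝒵_λ) = 𝒵_μ` for every principal surjection `f : λ ↠ μ`. -/
def C1 (Z : SubsetX A) : Prop :=
  ∀ (l m : IComp) (f : {i // i ∈ l.idx} → {j // j ∈ m.idx}),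
    IsPrincSurj l m f → alphaC A f ⁻¹' (Z l) = Z m

/-- `x ∈ 𝒳_λ` is `N`-approximable by `𝒵` if there are an `∞`-composition `μ` and an
injective function `f : ⟨λ⟩ → ⟨μ⟩` with `μ_{f(i)} ≥ min(λ_i, N)` for all `i` such that
`x ∈ α_f(𝒵_μ)`. -/
def NApprox (Z : SubsetX A) (l : IComp) (x : XSp A l) (N : ℕ) : Prop :=
  ∃ (m : IComp) (f : {i // i ∈ l.idx} → {j // j ∈ m.idx}),
    Function.Injective f ∧ (∀ i, min (l.w i.1) (N : ℕ∞) ≤ m.w (f i).1) ∧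
    x ∈ alphaC A f '' (Z m)

/-- `𝒵` is C2 if it is C1 and each `𝒵_λ` contains every point of `𝒳_λ` approximable
by `𝒵` (i.e. `N`-approximable for every positive integer `N`). -/
def C2 (Z : SubsetX A) : Prop :=
  C1 A Z ∧ ∀ (l : IComp) (x : XSp A l), (∀ N : ℕ, 0 < N → NApprox A Z l x N) → x ∈ Z l

/-- `𝒵` is a C3 subvariety if it is C2 and each `𝒵_λ` is Zariski closed in `𝒳_λ`. -/
def C3 (Z : SubsetX A) : Prop :=
  C2 A Z ∧ ∀ l : IComp, IsClosed (Z l)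

/-- Positive weights on a finite type, one of them infinite, are those of some `∞`-composition. -/
theorem exists_iComp_equiv {κ : Type*} [Fintype κ] (v : κ → ℕ∞) (hpos : ∀ k, 0 < v k)
    (hinf : ∃ k, v k = ⊤) :
    ∃ (n : IComp) (e : κ ≃ {i // i ∈ n.idx}), ∀ k, n.w (e k).1 = v k := by
  classical
  let c : κ ≃ Fin (Fintype.card κ) := Fintype.equivFin κ
  let w : ℕ → ℕ∞ := fun i => if h : i < Fintype.card κ then v (c.symm ⟨i, h⟩) else 0
  have hw : ∀ k, w (c k) = v k := fun k => by simp [w]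
  refine ⟨⟨Finset.range (Fintype.card κ), w, fun i hi => ?_, fun i hi => ?_, ?_⟩,
    c.trans (Fin.equivSubtype.trans
      (Equiv.subtypeEquivRight fun i => Finset.mem_range.symm)), hw⟩
  · simpa [w, Finset.mem_range.mp hi] using hpos _
  · simpa [w] using fun h => absurd (Finset.mem_range.mpr h) hi
  · obtain ⟨k, hk⟩ := hinf
    exact ⟨c k, Finset.mem_range.mpr (c k).2, (hw k).trans hk⟩

/-- Every map of `∞`-compositions is a weight-preserving injection followed by a principal
surjection. -/
theorem IsCompMap.exists_factorization {l m : IComp} {f : {i // i ∈ l.idx} → {j // j ∈ m.idx}}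
    (hf : IsCompMap l m f) :
    ∃ (n : IComp) (g : {i // i ∈ l.idx} → {k // k ∈ n.idx})
      (p : {k // k ∈ n.idx} → {j // j ∈ m.idx}),
      Function.Injective g ∧ (∀ i, n.w (g i).1 = l.w i.1) ∧ IsPrincSurj n m p ∧ p ∘ g = f := by
  classical
  let d : {j // j ∈ m.idx} → ℕ∞ := fun j =>
    m.w j.1 - ∑ i : {i // i ∈ l.idx}, if f i = j then l.w i.1 else 0
  obtain ⟨n, e, he⟩ := exists_iComp_equiv
    (Sum.elim (fun i : {i // i ∈ l.idx} => l.w i.1) (fun j : {j // d j ≠ 0} => d j.1))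
    (by
      rintro (i | j)
      · exact l.pos i.1 i.2
      · exact pos_iff_ne_zero.mpr j.2)
    (by
      obtain ⟨i, hi, hinf⟩ := l.inf
      exact ⟨Sum.inl ⟨i, hi⟩, hinf⟩)
  refine ⟨n, e ∘ Sum.inl, Sum.elim f Subtype.val ∘ e.symm,
    e.injective.comp Sum.inl_injective, fun i => he _, fun j => ?_, ?_⟩
  · have hd : ∑ k : {j // d j ≠ 0}, (if k.1 = j then d k.1 else 0) = d j := by
      by_cases hj : d j = 0
      · rw [hj]
        refine Finset.sum_eq_zero fun k _ => if_neg ?_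
        rintro rfl
        exact k.2 hj
      · rw [Finset.sum_eq_single ⟨j, hj⟩]
        · simp
        · exact fun k _ hk => if_neg fun h => hk (Subtype.ext h)
        · simp
    rw [← e.sum_comp, Fintype.sum_sum_type]
    simp only [Function.comp_apply, Equiv.symm_apply_apply, Sum.elim_inl, Sum.elim_inr, he]
    rw [hd]
    exact add_tsub_cancel_of_le (hf j)
  · ext i
    simp

theorem alphaC_comp {l n m : IComp} (g : {i // i ∈ l.idx} → {k // k ∈ n.idx})
    (p : {k // k ∈ n.idx} → {j // j ∈ m.idx}) (x : XSp A m) :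
    alphaC A (p ∘ g) x = alphaC A g (alphaC A p x) := by
  ext q
  simp [alphaC, rename_rename]

/-- If `𝒵` is a C2 subset of `𝒳` and `f : λ → μ` is a map of `∞`-compositions, then
`α_f(𝒵_μ) ⊆ 𝒵_λ`. -/
theorem statement5 (Z : SubsetX A) (hZ : C2 A Z)
    (l m : IComp) (f : {i // i ∈ l.idx} → {j // j ∈ m.idx}) (hf : IsCompMap l m f) :
    alphaC A f '' (Z m) ⊆ Z l := by
  rintro _ ⟨y, hy, rfl⟩
  obtain ⟨n, g, p, hg, hw, hp, rfl⟩ := hf.exists_factorization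
  refine hZ.2 l _ fun N _ => ⟨n, g, hg, fun i => (min_le_left _ _).trans (hw i).ge, alphaC A p y,
    ?_, (alphaC_comp A g p y).symm⟩
  rwa [← hZ.1 n m p hp] at hy

end
end

section
/- Let A be a commutative ring, let 𝒵 be a C2 subset of 𝒳, let r ≥ 1, and let λ¹ ≤ λ² ≤ ⋯ be a sequence of ∞-compositions on the common index set [r] = {1, …, r} with λⁿ_i ≤ λⁿ⁺¹_i for all i and n, and let λ be their pointwise supremum (also an ∞-composition on [r]). Then, viewing all of 𝒳_{λⁿ} and 𝒳_λ as the same affine space Spec A[t_1, …, t_r], one has 𝒵_λ = ⋂_{n ≥ 1} 𝒵_{λⁿ}. -/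
open MvPolynomial

noncomputable section

variable (A : Type) [CommRing A]

/-- A point of `𝒳_λ` lies in `𝒵_λ` as soon as, for every `N`, it lies in some `𝒵_μ` where `μ`
has the same index set as `λ` and dominates the truncation `min(λ, N)`. -/
theorem C2.mem_of_forall_exists {Z : SubsetX A} (hZ : C2 A Z) {s : Finset ℕ} {u : ℕ → ℕ∞}
    (hp : ∀ i ∈ s, 0 < u i) (hz : ∀ i ∉ s, u i = 0) (hi : ∃ i ∈ s, u i = ⊤)
    (x : PrimeSpectrum (MvPolynomial {i // i ∈ s} A))
    (h : ∀ N : ℕ, ∃ (v : ℕ → ℕ∞) (hp' : ∀ i ∈ s, 0 < v i) (hz' : ∀ i ∉ s, v i = 0)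
      (hi' : ∃ i ∈ s, v i = ⊤), (∀ i ∈ s, min (u i) (N : ℕ∞) ≤ v i) ∧ x ∈ Z ⟨s, v, hp', hz', hi'⟩) :
    x ∈ Z ⟨s, u, hp, hz, hi⟩ := by
  refine hZ.2 ⟨s, u, hp, hz, hi⟩ x fun N _ => ?_
  obtain ⟨v, hp', hz', hi', hv, hx⟩ := h N
  refine ⟨⟨s, v, hp', hz', hi'⟩, id, Function.injective_id, fun i => hv i.1 i.2, x, hx, ?_⟩
  ext p
  simp [alphaC]

/-- The supremum of a monotone sequence in `ℕ∞` is eventually attained up to truncation at `N`. -/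
theorem ENat.exists_forall_min_iSup_le {a : ℕ → ℕ∞} (ha : Monotone a) (N : ℕ) :
    ∃ n, ∀ m ≥ n, min (⨆ k, a k) (N : ℕ∞) ≤ a m := by
  by_cases h : ∃ n, (N : ℕ∞) ≤ a n
  · obtain ⟨n, hn⟩ := h
    exact ⟨n, fun m hm => (min_le_right _ _).trans (hn.trans (ha hm))⟩
  · push Not at h
    have hlt : ⨆ k, a k < ⊤ := (iSup_le fun k => (h k).le).trans_lt (ENat.natCast_lt_top N)
    obtain ⟨n, hn⟩ := ENat.exists_eq_iSup_of_lt_top hlt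
    exact ⟨n, fun m hm => (min_le_left _ _).trans (hn ▸ ha hm)⟩

/-- Let `𝒵` be a C2 subset of `𝒳`, `r ≥ 1`, and `λ¹ ≤ λ² ≤ ⋯` a pointwise increasing
sequence of `∞`-compositions on the common index set `{1, …, r}`, with pointwise supremum
`λ`. Then `𝒵_λ = ⋂_n 𝒵_{λⁿ}` (all these sets living in the same affine space
`Spec A[t_1, …, t_r]`). -/
theorem statement6 (Z : SubsetX A) (hZ : C2 A Z) (r : ℕ) (hr : 1 ≤ r)
    (w : ℕ → ℕ → ℕ∞)
    (hpos : ∀ n, ∀ i ∈ Finset.Icc 1 r, 0 < w n i)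
    (hzero : ∀ n, ∀ i ∉ Finset.Icc 1 r, w n i = 0)
    (hinf : ∀ n, ∃ i ∈ Finset.Icc 1 r, w n i = ⊤)
    (hmono : ∀ n i, w n i ≤ w (n + 1) i) :
    Z ⟨Finset.Icc 1 r, fun i => ⨆ n, w n i,
        fun i hi => lt_of_lt_of_le (hpos 0 i hi) (le_iSup (fun n => w n i) 0),
        fun i hi => by
          have h : ∀ n, w n i = 0 := fun n => hzero n i hi
          simp [h],
        by
          obtain ⟨i, hi, hw⟩ := hinf 0
          exact ⟨i, hi, top_unique (hw ▸ le_iSup (fun n => w n i) 0)⟩⟩ =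
      ⋂ n : ℕ, Z ⟨Finset.Icc 1 r, w n, hpos n, hzero n, hinf n⟩ := by
  have hm : ∀ i, Monotone fun n => w n i := fun i => monotone_nat_of_le_succ fun n => hmono n i
  ext x
  rw [Set.mem_iInter]
  constructor
  · intro hx n
    exact hZ.mem_of_forall_exists A _ _ _ x fun N =>
      ⟨_, _, _, _, fun i _ => (min_le_left _ _).trans (le_iSup (fun n => w n i) n), hx⟩
  · intro hx
    refine hZ.mem_of_forall_exists A _ _ _ x fun N => ?_
    choose n hn using fun i => ENat.exists_forall_min_iSup_le (hm i) N
    exact ⟨_, _, _, _, fun i hi => hn i _ (Finset.le_sup (f := n) hi),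
      hx ((Finset.Icc 1 r).sup n)⟩

end
end

section
/- Let A be a commutative ring, n ≥ 0, I an ideal of the polynomial ring A[y_1, …, y_n], and π : Spec A[y_1, …, y_n] → Spec A the morphism induced by the inclusion A → A[y_1, …, y_n]. Then the set W' = {p ∈ Spec A : every prime q of A[y_1, …, y_n] lying over p (i.e. with π(q) = p) contains I} — that is, the set of p whose entire fiber π⁻¹(p) is contained in the zero locus V(I) — is Zariski closed in Spec A. -/
open MvPolynomial

/-- Let `I` be an ideal of `A[y_1, …, y_n]` and `π : Spec A[y_1, …, y_n] → Spec A` the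
morphism induced by the inclusion `A → A[y_1, …, y_n]`. The set of primes `p` of `A` whose
entire fiber `π⁻¹(p)` is contained in `V(I)` — i.e. such that every prime lying over `p`
contains `I` — is Zariski closed in `Spec A`. -/
theorem statement13 (A : Type*) [CommRing A] (n : ℕ) (I : Ideal (MvPolynomial (Fin n) A)) :
    IsClosed {p : PrimeSpectrum A |
      ∀ q : PrimeSpectrum (MvPolynomial (Fin n) A),
        PrimeSpectrum.comap (C : A →+* MvPolynomial (Fin n) A) q = p → I ≤ q.asIdeal} := by
  convert (MvPolynomial.isOpenMap_comap_C _
    (PrimeSpectrum.isClosed_zeroLocus (I : Set (MvPolynomial (Fin n) A))).isOpen_compl).isClosed_compl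
    using 1
  ext p
  simp only [Set.mem_ofPred_eq, Set.mem_compl_iff, Set.mem_image, not_exists, not_and',
    PrimeSpectrum.mem_zeroLocus, SetLike.coe_subset_coe, not_not]
end

section
/- Let A be a noetherian commutative ring. Then the descending chain condition holds for C3 subvarieties of 𝒳: every chain 𝒵¹ ⊇ 𝒵² ⊇ 𝒵³ ⊇ ⋯ of C3 subvarieties of 𝒳 (meaning 𝒵ⁿ⁺¹_λ ⊆ 𝒵ⁿ_λ for every ∞-composition λ) is eventually constant. -/
open MvPolynomial

noncomputable section

variable (A : Type) [CommRing A]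

/-- The point of `𝒳_l` given by the field-valued point with coordinates `x i`. -/
def fieldPoint {K : Type} [Field K] (l : IComp) (φ : A →+* K) (x : ℕ → K) : XSp A l :=
  ⟨RingHom.ker (eval₂Hom φ fun i : {i // i ∈ l.idx} => x i.1), RingHom.ker_isPrime _⟩

variable {A}

theorem mem_fieldPoint {K : Type} [Field K] {l : IComp} {φ : A →+* K} {x : ℕ → K}
    {F : MvPolynomial {i // i ∈ l.idx} A} :
    F ∈ (fieldPoint A l φ x).asIdeal ↔ eval₂ φ (fun i => x i.1) F = 0 := by
  simp [fieldPoint, RingHom.mem_ker]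

theorem exists_eq_fieldPoint {l : IComp} (p : XSp A l) :
    ∃ (K : Type) (_ : Field K) (φ : A →+* K) (x : ℕ → K), p = fieldPoint A l φ x := by
  classical
  refine ⟨p.asIdeal.ResidueField, inferInstance,
    (algebraMap (MvPolynomial {i // i ∈ l.idx} A) p.asIdeal.ResidueField).comp C,
    fun i => if h : i ∈ l.idx then algebraMap (MvPolynomial {i // i ∈ l.idx} A) _ (X ⟨i, h⟩) else 0,
    PrimeSpectrum.ext ?_⟩
  have h : eval₂Hom ((algebraMap (MvPolynomial {i // i ∈ l.idx} A)
        p.asIdeal.ResidueField).comp C) (fun i : {i // i ∈ l.idx} =>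
        if h : i.1 ∈ l.idx then algebraMap (MvPolynomial {i // i ∈ l.idx} A) _ (X ⟨i.1, h⟩) else 0) =
      algebraMap (MvPolynomial {i // i ∈ l.idx} A) p.asIdeal.ResidueField := by
    ext i <;> simp
  simp only [fieldPoint]
  rw [h, Ideal.ker_algebraMap_residueField]

theorem alphaC_fieldPoint {K : Type} [Field K] {l m : IComp}
    (f : {i // i ∈ l.idx} → {j // j ∈ m.idx}) (φ : A →+* K) {x y : ℕ → K}
    (hxy : ∀ i, x i.1 = y (f i).1) :
    alphaC A f (fieldPoint A m φ y) = fieldPoint A l φ x := by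
  refine PrimeSpectrum.ext (Ideal.ext fun F => ?_)
  have h : (fun i : {i // i ∈ l.idx} => x i.1) = (fun j : {j // j ∈ m.idx} => y j.1) ∘ f :=
    funext hxy
  rw [mem_fieldPoint, h, ← eval₂_rename]
  exact mem_fieldPoint

theorem C1.mem_fieldPoint_iff {Z : SubsetX A} (hZ : C1 A Z) {K : Type} [Field K] {l m : IComp}
    (φ : A →+* K) {x y : ℕ → K} (h : ℕ → ℕ) (hm : ∀ i ∈ l.idx, h i ∈ m.idx)
    (hw : ∀ j ∈ m.idx, (∑ i ∈ l.idx, if h i = j then l.w i else 0) = m.w j)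
    (hxy : ∀ i ∈ l.idx, x i = y (h i)) :
    fieldPoint A m φ y ∈ Z m ↔ fieldPoint A l φ x ∈ Z l := by
  have hf : IsPrincSurj l m fun i => ⟨h i.1, hm i.1 i.2⟩ := by
    rintro ⟨j, hj⟩
    rw [← hw j hj]
    refine Eq.trans (Finset.sum_congr rfl fun i _ => ?_)
      (Finset.sum_coe_sort l.idx fun i => if h i = j then l.w i else 0)
    simp only [Subtype.mk.injEq]
  rw [← hZ l m _ hf, Set.mem_preimage, alphaC_fieldPoint]
  exact fun i => hxy i.1 i.2

theorem C2.mem_fieldPoint_of_injOn {Z : SubsetX A} (hZ : C2 A Z) {K : Type} [Field K]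
    {l m : IComp} (φ : A →+* K) {x y : ℕ → K} (h : ℕ → ℕ) (hm : ∀ i ∈ l.idx, h i ∈ m.idx)
    (hinj : Set.InjOn h l.idx) (hw : ∀ i ∈ l.idx, l.w i ≤ m.w (h i))
    (hxy : ∀ i ∈ l.idx, x i = y (h i)) (hy : fieldPoint A m φ y ∈ Z m) :
    fieldPoint A l φ x ∈ Z l := by
  refine hZ.2 l _ fun N _ => ⟨m, fun i => ⟨h i.1, hm i.1 i.2⟩, ?_, ?_, _, hy, ?_⟩
  · intro i j hij
    exact Subtype.ext (hinj i.2 j.2 (congrArg Subtype.val hij))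
  · exact fun i => (min_le_left _ _).trans (hw i.1 i.2)
  · exact alphaC_fieldPoint _ _ fun i => hxy i.1 i.2

/-- The `∞`-composition on `{0, …, k}` with weight `∞` at `0` and `v j + 1` at `1 ≤ j ≤ k`. -/
def stdComp (k : ℕ) (v : Fin (k + 1) → ℕ∞) : IComp where
  idx := Finset.range (k + 1)
  w j := if j = 0 then ⊤ else if j ≤ k then v (Fin.ofNat (k + 1) j) + 1 else 0
  pos j hj := by
    have : j ≤ k := by simpa [Nat.lt_succ_iff] using hj
    by_cases h : j = 0 <;> simp [h, this]
  zero j hj := by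
    have : ¬ j ≤ k := by simpa [Nat.lt_succ_iff] using hj
    have h0 : j ≠ 0 := by omega
    simp [h0, this]
  inf := ⟨0, by simp, by simp⟩

theorem stdComp_idx (k : ℕ) (v : Fin (k + 1) → ℕ∞) :
    (stdComp k v).idx = Finset.range (k + 1) := rfl

theorem stdComp_w_zero (k : ℕ) (v : Fin (k + 1) → ℕ∞) : (stdComp k v).w 0 = ⊤ := by
  simp [stdComp]

theorem stdComp_w {k : ℕ} (v : Fin (k + 1) → ℕ∞) {j : ℕ} (h0 : j ≠ 0) (hj : j ≤ k) :
    (stdComp k v).w j = v (Fin.ofNat (k + 1) j) + 1 := by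
  simp [stdComp, h0, hj]

/-- The part of a subset of `𝒳` at a standard composition, in a space depending on `k` only. -/
def stdPart (Z : SubsetX A) (k : ℕ) (v : Fin (k + 1) → ℕ∞) :
    Set (PrimeSpectrum (MvPolynomial {i // i ∈ Finset.range (k + 1)} A)) :=
  Z (stdComp k v)

theorem C2.mem_stdPart {Z : SubsetX A} (hZ : C2 A Z) {k : ℕ} {v : Fin (k + 1) → ℕ∞}
    {p : PrimeSpectrum (MvPolynomial {i // i ∈ Finset.range (k + 1)} A)}
    (h : ∀ N : ℕ, ∃ u, (∀ j, min (v j) N ≤ u j) ∧ p ∈ stdPart Z k u) : p ∈ stdPart Z k v := by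
  refine hZ.2 (stdComp k v) p fun N _ => ?_
  obtain ⟨u, hu, hp⟩ := h N
  refine ⟨stdComp k u, id, Function.injective_id, ?_, p, hp, ?_⟩
  · rintro ⟨j, hj⟩
    have hjk : j ≤ k := by simpa [stdComp_idx, Nat.lt_succ_iff] using hj
    by_cases h0 : j = 0
    · subst h0; simp [stdComp_w_zero]
    · simp only [id, stdComp_w _ h0 hjk]
      refine le_trans ?_ (add_le_add_left (hu _) 1)
      rw [← min_add_add_right]
      exact min_le_min le_rfl le_self_add
  · refine PrimeSpectrum.ext (Ideal.ext fun F => ?_)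
    change rename id F ∈ p.asIdeal ↔ F ∈ p.asIdeal
    rw [rename_id, AlgHom.id_apply]

theorem C2.stdPart_antitone {Z : SubsetX A} (hZ : C2 A Z) (k : ℕ) : Antitone (stdPart Z k) :=
  fun _ v h _ hp => hZ.mem_stdPart fun _ => ⟨v, fun j => (min_le_left _ _).trans (h j), hp⟩

theorem exists_min_iSup_le {u : ℕ → ℕ∞} (hu : Monotone u) (N : ℕ) :
    ∃ i, ∀ j, i ≤ j → min (⨆ n, u n) N ≤ u j := by
  suffices ∃ i, min (⨆ n, u n) N ≤ u i from
    this.imp fun i hi j hij => hi.trans (hu hij)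
  by_contra! hlt
  obtain ⟨M, hM⟩ : ∃ M : ℕ, (M : ℕ∞) = min (⨆ n, u n) N :=
    ENat.ne_top_iff_exists.mp (ne_top_of_le_ne_top (ENat.natCast_ne_top N) (min_le_right _ _))
  rw [← hM] at hlt
  have hpos : M ≠ 0 := by
    rintro rfl
    simpa using hlt 0
  obtain ⟨M, rfl⟩ := Nat.exists_eq_succ_of_ne_zero hpos
  have hle : ⨆ n, u n ≤ M := iSup_le fun n => by
    have := hlt n
    rw [Nat.succ_eq_add_one, Nat.cast_add, Nat.cast_one] at this
    exact (ENat.lt_natCast_add_one_iff).mp this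
  have : ((M + 1 : ℕ) : ℕ∞) ≤ M := (hM.le.trans (min_le_left _ _)).trans hle
  exact absurd (Nat.cast_le.mp this) (by omega)

theorem antitone_isClosed_stabilizes {R : Type*} [CommRing R] [IsNoetherianRing R]
    {s : ℕ → Set (PrimeSpectrum R)} (hs : Antitone s)
    (hc : ∀ n, IsClosed (s n)) : ∃ N, ∀ n, N ≤ n → s n = s N := by
  obtain ⟨N, hN⟩ := WellFoundedGT.monotone_chain_condition
    (α := TopologicalSpace.Opens (PrimeSpectrum R))
    ⟨fun n => ⟨(s n)ᶜ, (hc n).isOpen_compl⟩, fun a b h => Set.compl_subset_compl.mpr (hs h)⟩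
  refine ⟨N, fun n hn => compl_injective ?_⟩
  exact (congrArg
    (fun U : TopologicalSpace.Opens (PrimeSpectrum R) => (U : Set (PrimeSpectrum R))) (hN n hn)).symm

theorem stdPart_stabilizes [IsNoetherianRing A] {Zs : ℕ → SubsetX A} (hC3 : ∀ n, C3 A (Zs n))
    (hZ : ∀ l, Antitone fun n => Zs n l) (k : ℕ) :
    ∃ N, ∀ n, N ≤ n → ∀ v, stdPart (Zs n) k v = stdPart (Zs N) k v := by
  by_contra! H
  choose n hn v hv using H
  obtain ⟨g, hg⟩ := (wellQuasiOrdered_le (α := Fin (k + 1) → ℕ∞)).exists_monotone_subseq v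
  have hmono : Monotone (v ∘ g) := fun a b h => hg a b h
  let s : Fin (k + 1) → ℕ∞ := fun j => ⨆ i, v (g i) j
  obtain ⟨N₁, hN₁⟩ := antitone_isClosed_stabilizes
    (R := MvPolynomial {i // i ∈ Finset.range (k + 1)} A)
    (s := fun n => stdPart (Zs n) k s)
    (fun a b h => hZ (stdComp k s) h) fun n => (hC3 n).2 (stdComp k s)
  obtain ⟨N₂, hN₂⟩ := antitone_isClosed_stabilizes
    (R := MvPolynomial {i // i ∈ Finset.range (k + 1)} A)
    (s := fun N : ℕ => stdPart (Zs N₁) k fun j => min (s j) N)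
    (fun a b h => (hC3 N₁).1.stdPart_antitone k fun j =>
      min_le_min le_rfl (Nat.cast_le.mpr h)) fun n => (hC3 N₁).2 (stdComp k _)
  have hlim : stdPart (Zs N₁) k (fun j => min (s j) N₂) ⊆ stdPart (Zs N₁) k s := by
    intro p hp
    refine (hC3 N₁).1.mem_stdPart fun N => ?_
    rcases le_total N₂ N with h | h
    · exact ⟨_, fun j => le_rfl, (hN₂ N h).symm ▸ hp⟩
    · exact ⟨_, fun j => min_le_min le_rfl (Nat.cast_le.mpr h), hp⟩
  have hev : ∀ j, ∃ i, ∀ i', i ≤ i' → min (s j) N₂ ≤ v (g i') j := fun j =>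
    exists_min_iSup_le (fun a b h => hmono h j) N₂
  choose i hi using hev
  let e := max N₁ (Finset.univ.sup i)
  have hle : (fun j => min (s j) N₂) ≤ v (g e) := fun j =>
    hi j e ((Finset.le_sup (Finset.mem_univ j)).trans (le_max_right _ _))
  have hge : N₁ ≤ g e := (le_max_left _ _).trans g.strictMono.le_apply
  have hub : v (g e) ≤ s := fun j => le_iSup (fun i => v (g i) j) e
  apply hv (g e)
  apply subset_antisymm (hZ (stdComp k _) (hn (g e)))
  calc stdPart (Zs (g e)) k (v (g e)) ⊆ stdPart (Zs N₁) k (v (g e)) := hZ (stdComp k _) hge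
    _ ⊆ stdPart (Zs N₁) k (fun j => min (s j) N₂) := (hC3 N₁).1.stdPart_antitone k hle
    _ ⊆ stdPart (Zs N₁) k s := hlim
    _ = stdPart (Zs (n (g e))) k s := (hN₁ _ (hge.trans (hn _))).symm
    _ ⊆ stdPart (Zs (n (g e))) k (v (g e)) := (hC3 _).1.stdPart_antitone k hub

theorem exists_stdComp_princSurj {K : Type} (l : IComp) {i₀ : ℕ} (hi₀ : i₀ ∈ l.idx)
    (htop : l.w i₀ = ⊤) (x : ℕ → K) :
    ∃ (k : ℕ) (v : Fin (k + 1) → ℕ∞) (y : ℕ → K) (h : ℕ → ℕ),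
      (∀ i ∈ l.idx, h i ∈ (stdComp k v).idx) ∧
      (∀ j ∈ (stdComp k v).idx, (∑ i ∈ l.idx, if h i = j then l.w i else 0) = (stdComp k v).w j) ∧
      (∀ i ∈ l.idx, x i = y (h i)) ∧ Set.InjOn y (Set.Icc 1 k) := by
  classical
  let S := (l.idx.erase i₀).image x
  let e : S ≃ Fin S.card := S.equivFin
  let h : ℕ → ℕ := fun i =>
    if hi : i ∈ l.idx.erase i₀ then (e ⟨x i, Finset.mem_image_of_mem x hi⟩ : ℕ) + 1 else 0
  let y : ℕ → K := fun j => if hj : j - 1 < S.card ∧ j ≠ 0 then e.symm ⟨j - 1, hj.1⟩ else x i₀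
  let v : Fin (S.card + 1) → ℕ∞ := fun j =>
    (∑ i ∈ l.idx, if h i = j then l.w i else 0) - 1
  have h0 : h i₀ = 0 := by simp [h]
  refine ⟨S.card, v, y, h, fun i _ => ?_, fun j hj => ?_, fun i hi => ?_, ?_⟩
  · rw [stdComp_idx, Finset.mem_range]
    by_cases hi : i ∈ l.idx.erase i₀
    · simp only [h, dif_pos hi]; omega
    · simp only [h, dif_neg hi]; omega
  · rw [stdComp_idx, Finset.mem_range, Nat.lt_succ_iff] at hj
    by_cases hj0 : j = 0
    · subst hj0
      rw [stdComp_w_zero, eq_top_iff, ← htop]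
      refine le_trans (by rw [if_pos h0]) (Finset.single_le_sum
        (f := fun i => if h i = 0 then l.w i else 0) (fun _ _ => bot_le) hi₀)
    · rw [stdComp_w v hj0 hj]
      have hjv : ((Fin.ofNat (S.card + 1) j : Fin (S.card + 1)) : ℕ) = j := by
        simp [Nat.mod_eq_of_lt (Nat.lt_succ_of_le hj)]
      simp only [v, hjv]
      refine (tsub_add_cancel_of_le ?_).symm
      obtain ⟨i, hi, hix⟩ := Finset.mem_image.mp (e.symm ⟨j - 1, by omega⟩).2
      have hij : h i = j := by
        simp only [h, dif_pos hi, hix]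
        simp only [Subtype.coe_eta, Equiv.apply_symm_apply]
        omega
      have hil := Finset.mem_of_mem_erase hi
      calc (1 : ℕ∞) ≤ l.w i := Order.one_le_iff_pos.mpr (l.pos i hil)
        _ = if h i = j then l.w i else 0 := by rw [if_pos hij]
        _ ≤ _ := Finset.single_le_sum
          (f := fun i => if h i = j then l.w i else 0) (fun _ _ => bot_le) hil
  · by_cases hi' : i ∈ l.idx.erase i₀
    · have hh : h i = (e ⟨x i, Finset.mem_image_of_mem x hi'⟩ : ℕ) + 1 := dif_pos hi'
      rw [hh]
      simp [y]
    · have : i = i₀ := by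
        by_contra hne
        exact hi' (Finset.mem_erase.mpr ⟨hne, hi⟩)
      simp [y, this, h0]
  · intro a ha b hb hab
    rw [Set.mem_Icc] at ha hb
    simp only [y, dif_pos (show a - 1 < S.card ∧ a ≠ 0 by omega),
      dif_pos (show b - 1 < S.card ∧ b ≠ 0 by omega)] at hab
    have := e.symm.injective (Subtype.ext hab)
    rw [Fin.mk.injEq] at this
    omega

theorem exists_unit_princSurj {k : ℕ} {u : Fin (k + 1) → ℕ∞} (hu : ∀ j, u j ≠ ⊤) :
    ∃ (l : IComp) (h : ℕ → ℕ), 0 ∈ l.idx ∧ l.w 0 = ⊤ ∧ h 0 = 0 ∧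
      (∀ i ∈ l.idx, i ≠ 0 → l.w i = 1) ∧
      (∀ i ∈ l.idx, h i ∈ (stdComp k u).idx) ∧
      (∀ j ∈ (stdComp k u).idx,
        (∑ i ∈ l.idx, if h i = j then l.w i else 0) = (stdComp k u).w j) := by
  classical
  choose n hn using fun j => ENat.ne_top_iff_exists.mp (hu j)
  let c : ℕ → ℕ := fun j => if j = 0 then 1 else n (Fin.ofNat (k + 1) j) + 1
  let s : Finset ℕ := (Finset.range (k + 1)).biUnion fun j => (Finset.range (c j)).image (Nat.pair j)
  have h0s : 0 ∈ s := Finset.mem_biUnion.mpr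
    ⟨0, by simp, Finset.mem_image.mpr ⟨0, by simp [c], by simp [Nat.pair]⟩⟩
  let l : IComp :=
    { idx := s
      w := fun i => if i ∈ s then if i = 0 then ⊤ else 1 else 0
      pos := fun i hi => by by_cases h : i = 0 <;> simp [hi, h, h0s]
      zero := fun i hi => by simp [hi]
      inf := ⟨0, h0s, by simp [h0s]⟩ }
  have hlw : ∀ i ∈ s, l.w i = if i = 0 then ⊤ else 1 := fun i hi => if_pos hi
  refine ⟨l, fun i => i.unpair.1, h0s, by simp [hlw 0 h0s], by simp, fun i hi h0 => ?_,
    fun i hi => ?_, fun j hj => ?_⟩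
  · rw [hlw i hi, if_neg h0]
  · obtain ⟨j, hj, hi⟩ := Finset.mem_biUnion.mp (show i ∈ s from hi)
    obtain ⟨r, -, rfl⟩ := Finset.mem_image.mp hi
    simpa [stdComp_idx] using hj
  · have hfib : (l.idx.filter fun i => i.unpair.1 = j) =
        (Finset.range (c j)).image (Nat.pair j) := by
      ext i
      simp only [Finset.mem_filter, l, s, Finset.mem_biUnion, Finset.mem_image]
      constructor
      · rintro ⟨⟨j', -, r, hr, rfl⟩, hj'⟩
        rw [Nat.unpair_pair] at hj'
        subst hj'
        exact ⟨r, hr, rfl⟩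
      · rintro ⟨r, hr, rfl⟩
        exact ⟨⟨j, hj, r, hr, rfl⟩, by simp⟩
    have hsub : ∀ r ∈ Finset.range (c j), Nat.pair j r ∈ s := fun r hr =>
      Finset.mem_biUnion.mpr ⟨j, hj, Finset.mem_image_of_mem _ hr⟩
    rw [← Finset.sum_filter, hfib, Finset.sum_image fun a _ b _ hab => (Nat.pair_eq_pair.mp hab).2]
    rw [Finset.sum_congr rfl fun r hr => hlw _ (hsub r hr)]
    rw [stdComp_idx, Finset.mem_range, Nat.lt_succ_iff] at hj
    by_cases hj0 : j = 0
    · subst hj0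
      simp [c, stdComp_w_zero, Nat.pair]
    · have hpair : ∀ r, Nat.pair j r ≠ 0 := fun r hr => by
        have := Nat.left_le_pair j r
        omega
      simp [hpair, stdComp_w _ hj0 hj, c, hj0, ← hn]

theorem exists_bound_of_eval₂_ne_zero {l : IComp} {i₀ : ℕ} (hi₀ : i₀ ∈ l.idx)
    (F : MvPolynomial {i // i ∈ l.idx} A) {K₀ : Type} [Field K₀] (φ₀ : A →+* K₀) (x₀ : ℕ → K₀)
    (hF : eval₂ φ₀ (fun i => x₀ i.1) F ≠ 0) :
    ∃ g : Polynomial A, g.eval₂ φ₀ (x₀ i₀) ≠ 0 ∧ ∃ M : ℕ,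
      ∀ (K : Type) [Field K] (φ : A →+* K) (x : ℕ → K) (k : ℕ), g.eval₂ φ (x 0) ≠ 0 →
        Set.InjOn x (Set.Icc 1 k) → M ≤ k → ∃ h : ℕ → ℕ, Set.InjOn h l.idx ∧ h i₀ = 0 ∧
          (∀ i ∈ l.idx, i ≠ i₀ → h i ∈ Set.Icc 1 k) ∧
          eval₂ φ (fun i => x (h i.1)) F ≠ 0 := by
  classical
  let Θ : MvPolynomial {i // i ∈ l.idx} A →+* MvPolynomial {i // i ∈ l.idx} (Polynomial A) :=
    eval₂Hom (C.comp Polynomial.C) fun i => if i.1 = i₀ then C Polynomial.X else X i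
  have key : ∀ {K : Type} [Field K] (φ : A →+* K) (c : K) (y z : {i // i ∈ l.idx} → K),
      (∀ i, i.1 ≠ i₀ → y i = z i) → z ⟨i₀, hi₀⟩ = c →
      eval₂ φ z F = eval y (map (Polynomial.eval₂RingHom φ c) (Θ F)) := by
    intro K _ φ c y z hyz hz
    have : eval₂Hom φ z = ((eval y).comp (map (Polynomial.eval₂RingHom φ c))).comp Θ := by
      refine ringHom_ext (fun a => by simp [Θ]) fun i => ?_
      by_cases hi : i.1 = i₀
      · have hi' : i = ⟨i₀, hi₀⟩ := Subtype.ext hi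
        subst hi'
        simp [Θ, hz]
      · simp [Θ, hi, hyz i hi]
    exact congrArg (fun f => f F) this
  have hne : map (Polynomial.eval₂RingHom φ₀ (x₀ i₀)) (Θ F) ≠ 0 := by
    intro h
    rw [key φ₀ (x₀ i₀) _ _ (fun _ _ => rfl) rfl, h, map_zero] at hF
    exact hF rfl
  obtain ⟨m, hm⟩ := ne_zero_iff.mp hne
  rw [coeff_map] at hm
  refine ⟨coeff m (Θ F), hm, Fintype.card {i // i ∈ l.idx} * ((Θ F).totalDegree + 1), ?_⟩
  intro K _ φ x k hg hx hk
  set d := (Θ F).totalDegree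
  let e := Fintype.equivFin {i // i ∈ l.idx}
  let pos : {i // i ∈ l.idx} → ℕ → ℕ := fun i t => 1 + (e i * (d + 1) + t)
  have hpos : ∀ i t, t < d + 1 → pos i t ∈ Set.Icc 1 k := by
    intro i t ht
    have h1 : ((e i : ℕ) + 1) * (d + 1) ≤ Fintype.card {i // i ∈ l.idx} * (d + 1) :=
      Nat.mul_le_mul_right _ (e i).2
    rw [Nat.succ_mul] at h1
    simp only [pos, Set.mem_Icc]
    omega
  let S : {i // i ∈ l.idx} → Finset K := fun i => (Finset.range (d + 1)).image fun t => x (pos i t)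
  have hcard : ∀ i, (S i).card = d + 1 := by
    intro i
    rw [Finset.card_image_of_injOn, Finset.card_range]
    intro a ha b hb hab
    rw [Finset.coe_range, Set.mem_Iio] at ha hb
    have := hx (hpos i a ha) (hpos i b hb) hab
    simp only [pos] at this
    omega
  have hne' : map (Polynomial.eval₂RingHom φ (x 0)) (Θ F) ≠ 0 :=
    ne_zero_iff.mpr ⟨m, by rwa [coeff_map]⟩
  obtain ⟨y, hyS, hy⟩ : ∃ y : {i // i ∈ l.idx} → K, (∀ i, y i ∈ S i) ∧
      eval y (map (Polynomial.eval₂RingHom φ (x 0)) (Θ F)) ≠ 0 := by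
    by_contra! H
    refine hne' (eq_zero_of_eval_zero_at_prod_finset _ S (fun i => ?_) H)
    rw [hcard, Nat.lt_succ_iff]
    exact (degreeOf_le_totalDegree _ _).trans (Finset.sup_mono (support_map_subset _ _))
  choose t ht hty using fun i => Finset.mem_image.mp (hyS i)
  let h : ℕ → ℕ := fun i => if hi : i ∈ l.idx ∧ i ≠ i₀ then pos ⟨i, hi.1⟩ (t ⟨i, hi.1⟩) else 0
  have hh : ∀ i (hi : i ∈ l.idx), i ≠ i₀ → h i = pos ⟨i, hi⟩ (t ⟨i, hi⟩) := fun i hi hne =>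
    dif_pos ⟨hi, hne⟩
  have hh0 : h i₀ = 0 := by simp [h]
  have hmem : ∀ i ∈ l.idx, i ≠ i₀ → h i ∈ Set.Icc 1 k := fun i hi hne => by
    rw [hh i hi hne]
    exact hpos _ _ (Finset.mem_range.mp (ht _))
  refine ⟨h, fun a ha b hb hab => ?_, hh0, hmem, ?_⟩
  · by_cases ha0 : a = i₀ <;> by_cases hb0 : b = i₀
    · rw [ha0, hb0]
    · have := (hmem b hb hb0).1
      rw [← hab, ha0, hh0] at this
      omega
    · have := (hmem a ha ha0).1
      rw [hab, hb0, hh0] at this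
      omega
    · rw [hh a ha ha0, hh b hb hb0] at hab
      simp only [pos] at hab
      have hab' := Nat.add_left_cancel hab
      have h1 := Finset.mem_range.mp (ht ⟨a, ha⟩)
      have h2 := Finset.mem_range.mp (ht ⟨b, hb⟩)
      have h3 := congrArg (· / (d + 1)) hab'
      simp only [mul_comm _ (d + 1),
        Nat.mul_add_div (Nat.succ_pos d), Nat.div_eq_of_lt h1, Nat.div_eq_of_lt h2, add_zero] at h3
      exact congrArg Subtype.val (e.injective (Fin.ext h3))
  · rw [key φ (x 0) y _ (fun i hi => ?_) (by simp only [hh0])]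
    · exact hy
    · rw [← hty i, hh i.1 i.2 hi]

theorem C2.mem_stdComp_of_forall_unit {Z : SubsetX A} (hZ : C2 A Z) {I : Ideal (Polynomial A)}
    (hall : ∀ (l : IComp) (i₀ : ℕ), i₀ ∈ l.idx → l.w i₀ = ⊤ →
      (∀ i ∈ l.idx, i ≠ i₀ → l.w i = 1) → ∀ (K : Type) [Field K] (φ : A →+* K) (x : ℕ → K),
      (∀ p ∈ I, p.eval₂ φ (x i₀) = 0) → fieldPoint A l φ x ∈ Z l)
    {K : Type} [Field K] (φ : A →+* K) (x : ℕ → K) (hx : ∀ p ∈ I, p.eval₂ φ (x 0) = 0)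
    (k : ℕ) (v : Fin (k + 1) → ℕ∞) : fieldPoint A (stdComp k v) φ x ∈ Z (stdComp k v) := by
  refine hZ.mem_stdPart fun N => ⟨fun j => min (v j) N, fun j => le_rfl, ?_⟩
  obtain ⟨l, h, h0, htop, hh0, hone, hm, hw⟩ := exists_unit_princSurj
    (u := fun j => min (v j) N) fun j => ne_top_of_le_ne_top (ENat.natCast_ne_top N)
      (min_le_right _ _)
  refine (hZ.1.mem_fieldPoint_iff φ h hm hw (x := x ∘ h) fun i _ => rfl).mpr ?_
  refine hall l 0 h0 htop hone K φ _ fun p hp => ?_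
  rw [Function.comp_apply, hh0]
  exact hx p hp

theorem exists_stabilizes_over [IsNoetherianRing A] {Zs : ℕ → SubsetX A}
    (hC3 : ∀ n, C3 A (Zs n)) (hZ : ∀ l, Antitone fun n => Zs n l) (I : Ideal (Polynomial A)) :
    ∃ N, ∀ n, N ≤ n → ∀ (k : ℕ) (v : Fin (k + 1) → ℕ∞) (K : Type) [Field K] (φ : A →+* K)
      (x : ℕ → K), (∀ p ∈ I, p.eval₂ φ (x 0) = 0) → Set.InjOn x (Set.Icc 1 k) →
      fieldPoint A (stdComp k v) φ x ∈ Zs N (stdComp k v) →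
      fieldPoint A (stdComp k v) φ x ∈ Zs n (stdComp k v) := by
  induction I using IsNoetherian.induction with
  | hgt I ih =>
  by_cases hall : ∀ (n : ℕ) (l : IComp) (i₀ : ℕ), i₀ ∈ l.idx → l.w i₀ = ⊤ →
      (∀ i ∈ l.idx, i ≠ i₀ → l.w i = 1) → ∀ (K : Type) [Field K] (φ : A →+* K) (x : ℕ → K),
      (∀ p ∈ I, p.eval₂ φ (x i₀) = 0) → fieldPoint A l φ x ∈ Zs n l
  · exact ⟨0, fun n _ k v K _ φ x hx _ _ =>
      (hC3 n).1.mem_stdComp_of_forall_unit (hall n) φ x hx k v⟩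
  push Not at hall
  obtain ⟨n₀, l, i₀, hi₀, htop, hone, K₀, _, φ₀, x₀, hx₀, hnot⟩ := hall
  obtain ⟨s, hs⟩ := (PrimeSpectrum.isClosed_iff_zeroLocus _).mp ((hC3 n₀).2 l)
  rw [hs, PrimeSpectrum.mem_zeroLocus, Set.not_subset] at hnot
  obtain ⟨F, hFs, hF⟩ := hnot
  obtain ⟨g, hg, M, hM⟩ := exists_bound_of_eval₂_ne_zero hi₀ F φ₀ x₀
    fun h => hF (mem_fieldPoint.mpr h)
  have hgI : g ∉ I := fun h => hg (hx₀ g h)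
  obtain ⟨N₁, hN₁⟩ := ih (I ⊔ Ideal.span {g}) (lt_of_le_of_ne le_sup_left fun h =>
    hgI (h ▸ Ideal.mem_sup_right (Ideal.mem_span_singleton_self g)))
  choose N₂ hN₂ using stdPart_stabilizes hC3 hZ
  refine ⟨max (max n₀ N₁) ((Finset.range M).sup N₂), fun n hn k v K _ φ x hx hinj hmem => ?_⟩
  by_cases hgx : g.eval₂ φ (x 0) = 0
  · refine hN₁ n (by omega) k v K φ x (fun p hp => ?_) hinj (hZ _ (by omega) hmem)
    obtain ⟨a, ha, b, hb, rfl⟩ := Submodule.mem_sup.mp hp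
    obtain ⟨c, rfl⟩ := Ideal.mem_span_singleton.mp hb
    simp [hx a ha, Polynomial.eval₂_mul, hgx]
  · have hk : k < M := by
      by_contra! hk
      obtain ⟨h, hinjh, hh0, hIcc, hne⟩ := hM K φ x k hgx hinj hk
      have hlZ : fieldPoint A l φ (x ∘ h) ∈ Zs n₀ l := by
        refine (hC3 n₀).1.mem_fieldPoint_of_injOn (m := stdComp k v) (y := x) φ h
          (fun i hi => ?_) hinjh (fun i hi => ?_) (fun _ _ => rfl) (hZ _ (by omega) hmem)
        · rw [stdComp_idx, Finset.mem_range, Nat.lt_succ_iff]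
          by_cases hii : i = i₀
          · simp [hii, hh0]
          · exact (hIcc i hi hii).2
        · by_cases hii : i = i₀
          · simp [hii, hh0, stdComp_w_zero]
          · have := hIcc i hi hii
            rw [hone i hi hii, stdComp_w v (Nat.one_le_iff_ne_zero.mp this.1) this.2]
            exact le_add_self
      rw [hs] at hlZ
      exact hne (mem_fieldPoint.mp (hlZ hFs))
    have hkN : N₂ k ≤ (Finset.range M).sup N₂ := Finset.le_sup (Finset.mem_range.mpr hk)
    have h1 : fieldPoint A (stdComp k v) φ x ∈ stdPart (Zs (N₂ k)) k v :=
      hZ _ (by omega) hmem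
    rw [← hN₂ k n (by omega) v] at h1
    exact h1

variable (A)

/-- (A noetherian) The descending chain condition holds for C3 subvarieties of `𝒳`:
every decreasing chain `𝒵¹ ⊇ 𝒵² ⊇ ⋯` of C3 subvarieties is eventually constant. -/
theorem statement14 [IsNoetherianRing A]
    (Zs : ℕ → SubsetX A) (hC3 : ∀ n, C3 A (Zs n))
    (hchain : ∀ n (l : IComp), Zs (n + 1) l ⊆ Zs n l) :
    ∃ N : ℕ, ∀ n, N ≤ n → Zs n = Zs N := by
  have hZ : ∀ l, Antitone fun n => Zs n l := fun l => antitone_nat_of_succ_le fun n => hchain n l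
  obtain ⟨N, hN⟩ := exists_stabilizes_over hC3 hZ ⊥
  refine ⟨N, fun n hn => funext fun l => (hZ l hn).antisymm fun p hp => ?_⟩
  obtain ⟨K, _, φ, x, rfl⟩ := exists_eq_fieldPoint p
  obtain ⟨i₀, hi₀, htop⟩ := l.inf
  obtain ⟨k, v, y, h, hm, hw, hxy, hinj⟩ := exists_stdComp_princSurj l hi₀ htop x
  refine ((hC3 n).1.1.mem_fieldPoint_iff φ h hm hw hxy).mp ?_
  refine hN n hn k v K φ y (fun p hp => ?_) hinj
    (((hC3 N).1.1.mem_fieldPoint_iff φ h hm hw hxy).mpr hp)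
  rw [Ideal.mem_bot.mp hp, Polynomial.eval₂_zero]

end
end

section
/- Let A be a noetherian commutative ring and let M be a smooth 𝔖-equivariant R-module that is finitely 𝔖-generated. Then the support supp(M) = {p ∈ 𝔛 : M_p ≠ 0} is Zariski dense in V(Ann_R(M)); that is, supp(M) ⊆ V(Ann_R(M)) and the Zariski closure of supp(M) equals V(Ann_R(M)). -/
open MvPolynomial

noncomputable section

theorem FinSupp.one : FinSupp 1 := by
  simp [FinSupp]

theorem FinSupp.mul {σ τ : Equiv.Perm ℕ} (hσ : FinSupp σ) (hτ : FinSupp τ) :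
    FinSupp (σ * τ) := by
  refine (Set.Finite.union hσ hτ).subset fun x hx => ?_
  by_contra h
  simp only [Set.mem_union, Set.mem_ofPred_eq, not_or, not_not] at h
  exact hx (by simp [h.1, h.2])

theorem FinSupp.inv {σ : Equiv.Perm ℕ} (hσ : FinSupp σ) : FinSupp σ⁻¹ := by
  refine Set.Finite.subset hσ fun x hx h => hx ?_
  rw [Equiv.Perm.inv_eq_iff_eq, h]

theorem FinSupp.swap (a b : ℕ) : FinSupp (Equiv.swap a b) := by
  refine (Set.toFinite {a, b}).subset fun x hx => ?_
  by_contra h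
  simp only [Set.mem_insert_iff, Set.mem_singleton_iff, not_or] at h
  exact hx (Equiv.swap_apply_of_ne_of_ne h.1 h.2)

/-- A finite set can be moved into an initial segment of controlled length, keeping a given
initial segment fixed. -/
theorem exists_finSupp_forall_lt (n : ℕ) (T : Finset ℕ) :
    ∃ ρ : Equiv.Perm ℕ, FinSupp ρ ∧ (∀ i < n, ρ i = i) ∧ ∀ t ∈ T, ρ t < n + T.card := by
  induction T using Finset.induction_on with
  | empty => exact ⟨1, FinSupp.one, fun _ _ => rfl, by simp⟩
  | insert t T ht ih =>
    obtain ⟨ρ, hρ, hfix, hlt⟩ := ih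
    rw [Finset.card_insert_of_notMem ht]
    by_cases hu : ρ t < n
    · refine ⟨ρ, hρ, hfix, fun s hs => ?_⟩
      rcases Finset.mem_insert.1 hs with rfl | hs
      · omega
      · have := hlt s hs
        omega
    · refine ⟨Equiv.swap (ρ t) (n + T.card) * ρ, (FinSupp.swap _ _).mul hρ, fun i hi => ?_,
        fun s hs => ?_⟩
      · rw [Equiv.Perm.mul_apply, hfix i hi]
        exact Equiv.swap_apply_of_ne_of_ne (by omega) (by omega)
      · rw [Equiv.Perm.mul_apply]
        rcases Finset.mem_insert.1 hs with rfl | hs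
        · rw [Equiv.swap_apply_left]
          omega
        · have h := hlt s hs
          have hne : ρ s ≠ ρ t := fun h' => ht (ρ.injective h' ▸ hs)
          rw [Equiv.swap_apply_of_ne_of_ne hne (by omega)]
          omega

/-- A polynomial has finitely many renamings into a bounded set of variables. -/
theorem finite_rename_of_vars_lt {A : Type*} [CommRing A] (f : MvPolynomial ℕ A) (K : ℕ) :
    {g : MvPolynomial ℕ A | ∃ e : ℕ → ℕ, (∀ i ∈ f.vars, e i < K) ∧ g = rename e f}.Finite := by
  refine (Set.finite_range fun c : f.vars → Fin K =>
    rename (fun i => if h : i ∈ f.vars then (c ⟨i, h⟩ : ℕ) else 0) f).subset ?_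
  rintro _ ⟨e, he, rfl⟩
  refine ⟨fun i => ⟨e i, he i i.2⟩, ?_⟩
  refine hom_congr_vars (f₁ := (rename _ : MvPolynomial ℕ A →ₐ[A] _).toRingHom)
    (f₂ := (rename e : MvPolynomial ℕ A →ₐ[A] _).toRingHom) ?_ ?_ rfl
  · ext; simp
  · intro i hi _
    simp [hi]

/-- An element lying in every prime of the support acts nilpotently on each vector. -/
theorem exists_pow_smul_eq_zero_of_mem_support {R M : Type*} [CommRing R] [AddCommGroup M]
    [Module R M] {f : R} (hf : ∀ p ∈ Module.support R M, f ∈ p.asIdeal) (y : M) :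
    ∃ k : ℕ, f ^ k • y = 0 := by
  have : f ∈ (R ∙ y).annihilator.radical := by
    rw [Ideal.radical_eq_sInf, Ideal.mem_sInf]
    rintro J ⟨hJ, hp⟩
    exact hf ⟨J, hp⟩ (Module.mem_support_iff_exists_annihilator.2 ⟨y, hJ⟩)
  obtain ⟨k, hk⟩ := this
  exact ⟨k, (Submodule.mem_annihilator_span_singleton _ _).1 hk⟩

/-- If every renaming of `f` by a finitely supported permutation acts nilpotently on `x`, and
renaming by permutations fixing `0, …, n - 1` preserves the annihilator of `x`, then the exponents
are bounded. -/
theorem exists_uniform_pow_smul_eq_zero {A M : Type*} [CommRing A] [AddCommGroup M]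
    [Module (MvPolynomial ℕ A) M] (f : MvPolynomial ℕ A) (x : M) (n : ℕ)
    (hstab : ∀ ρ : Equiv.Perm ℕ, FinSupp ρ → (∀ i < n, ρ i = i) →
      ∀ r : MvPolynomial ℕ A, rename ρ r • x = 0 → r • x = 0)
    (hnil : ∀ σ : Equiv.Perm ℕ, FinSupp σ → ∃ k : ℕ, rename σ f ^ k • x = 0) :
    ∃ N : ℕ, ∀ σ : Equiv.Perm ℕ, FinSupp σ → rename σ f ^ N • x = 0 := by
  have hfin := finite_rename_of_vars_lt f (n + f.vars.card)
  have hk : ∀ g : MvPolynomial ℕ A, ∃ k : ℕ, (∃ l : ℕ, g ^ l • x = 0) → g ^ k • x = 0 := by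
    intro g
    by_cases h : ∃ l : ℕ, g ^ l • x = 0
    · exact h.imp fun _ hl _ => hl
    · exact ⟨0, fun h' => absurd h' h⟩
  choose k hk using hk
  refine ⟨hfin.toFinset.sup k, fun σ hσ => ?_⟩
  obtain ⟨ρ, hρ, hfix, hlt⟩ := exists_finSupp_forall_lt n (f.vars.image σ)
  refine hstab ρ hρ hfix _ ?_
  rw [map_pow, rename_rename, ← Equiv.Perm.coe_mul]
  have hmem : rename (ρ * σ : Equiv.Perm ℕ) f ∈ hfin.toFinset := by
    rw [Set.Finite.mem_toFinset]
    refine ⟨_, fun i hi => ?_, rfl⟩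
    have := hlt (σ i) (Finset.mem_image_of_mem _ hi)
    rwa [Finset.card_image_of_injective _ σ.injective] at this
  obtain ⟨j, hj⟩ := Nat.exists_eq_add_of_le (Finset.le_sup (f := k) hmem)
  rw [hj, add_comm, pow_add, mul_smul, hk _ (hnil _ (hρ.mul hσ)), smul_zero]

/-- (A noetherian) Let `M` be a smooth `𝔖`-equivariant `R`-module that is finitely
`𝔖`-generated, the `𝔖`-action being given by additive maps `φ σ : M → M` for finitely
supported permutations `σ`, compatible with composition and the identity, semilinear over
the renaming action on `R`, smooth (each element is fixed by all `σ` fixing `0, …, n-1`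
for some `n`), with `M` generated over `R` by the `𝔖`-orbits of finitely many elements.
Then `supp(M) = {p : M_p ≠ 0}` is contained in `V(Ann_R(M))` and is Zariski dense in it. -/
theorem statement19 (A : Type*) [CommRing A] [IsNoetherianRing A]
    (M : Type*) [AddCommGroup M] [Module (MvPolynomial ℕ A) M]
    (φ : (σ : Equiv.Perm ℕ) → FinSupp σ → (M →+ M))
    (hone : ∀ (h : FinSupp 1) (m : M), φ 1 h m = m)
    (hcomp : ∀ (σ τ : Equiv.Perm ℕ) (hσ : FinSupp σ) (hτ : FinSupp τ)
      (hστ : FinSupp (σ * τ)) (m : M), φ (σ * τ) hστ m = φ σ hσ (φ τ hτ m))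
    (hsmul : ∀ (σ : Equiv.Perm ℕ) (hσ : FinSupp σ) (r : MvPolynomial ℕ A) (m : M),
      φ σ hσ (r • m) = (rename ⇑σ r) • (φ σ hσ m))
    (hsmooth : ∀ m : M, ∃ n : ℕ, ∀ (σ : Equiv.Perm ℕ) (hσ : FinSupp σ),
      (∀ i < n, σ i = i) → φ σ hσ m = m)
    (hgen : ∃ s : Finset M, (⊤ : Submodule (MvPolynomial ℕ A) M) =
      Submodule.span (MvPolynomial ℕ A)
        {m : M | ∃ x ∈ s, ∃ (σ : Equiv.Perm ℕ) (hσ : FinSupp σ), m = φ σ hσ x}) :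
    {p : PrimeSpectrum (MvPolynomial ℕ A) |
        Nontrivial (LocalizedModule p.asIdeal.primeCompl M)} ⊆
      PrimeSpectrum.zeroLocus
        (((⊤ : Submodule (MvPolynomial ℕ A) M).annihilator : Ideal (MvPolynomial ℕ A)) :
          Set (MvPolynomial ℕ A)) ∧
    closure {p : PrimeSpectrum (MvPolynomial ℕ A) |
        Nontrivial (LocalizedModule p.asIdeal.primeCompl M)} =
      PrimeSpectrum.zeroLocus
        (((⊤ : Submodule (MvPolynomial ℕ A) M).annihilator : Ideal (MvPolynomial ℕ A)) :
          Set (MvPolynomial ℕ A)) := by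
  have hinv : ∀ (σ : Equiv.Perm ℕ) (hσ : FinSupp σ) (m : M), φ σ hσ (φ σ⁻¹ hσ.inv m) = m := by
    intro σ hσ m
    have h := hcomp σ σ⁻¹ hσ hσ.inv (hσ.mul hσ.inv) m
    rw [← h]
    simp only [mul_inv_cancel]
    exact hone _ m
  have hinv' : ∀ (σ : Equiv.Perm ℕ) (hσ : FinSupp σ) (m : M), φ σ⁻¹ hσ.inv (φ σ hσ m) = m := by
    intro σ hσ m
    have h := hcomp σ⁻¹ σ hσ.inv hσ (hσ.inv.mul hσ) m
    rw [← h]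
    simp only [inv_mul_cancel]
    exact hone _ m
  have hpull : ∀ (σ : Equiv.Perm ℕ) (hσ : FinSupp σ) (r : MvPolynomial ℕ A) (m : M),
      rename σ r • φ σ hσ m = 0 → r • m = 0 := by
    intro σ hσ r m h
    rw [← hsmul σ hσ] at h
    rw [← hinv' σ hσ (r • m), h, map_zero]
  have hsub : Module.support (MvPolynomial ℕ A) M ⊆ PrimeSpectrum.zeroLocus
      ((⊤ : Submodule (MvPolynomial ℕ A) M).annihilator : Set (MvPolynomial ℕ A)) := by
    intro p hp r hr
    obtain ⟨m, hm⟩ := Module.mem_support_iff_exists_annihilator.1 hp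
    exact hm ((Submodule.mem_annihilator_span_singleton _ _).2
      (Submodule.mem_annihilator.1 hr m trivial))
  change Module.support (MvPolynomial ℕ A) M ⊆ _ ∧
    closure (Module.support (MvPolynomial ℕ A) M) = _
  refine ⟨hsub, subset_antisymm
    (closure_minimal hsub (PrimeSpectrum.isClosed_zeroLocus _)) ?_⟩
  rw [← PrimeSpectrum.zeroLocus_vanishingIdeal_eq_closure]
  intro q hq f hf
  have hf' : ∀ p ∈ Module.support (MvPolynomial ℕ A) M, f ∈ p.asIdeal :=
    (PrimeSpectrum.mem_vanishingIdeal _ _).1 hf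
  obtain ⟨s, hs⟩ := hgen
  have hbound : ∀ x : M, ∃ N : ℕ, ∀ (σ : Equiv.Perm ℕ) (hσ : FinSupp σ),
      f ^ N • φ σ hσ x = 0 := by
    intro x
    obtain ⟨n, hn⟩ := hsmooth x
    obtain ⟨N, hN⟩ := exists_uniform_pow_smul_eq_zero f x n
      (fun ρ hρ hfix r h => hpull ρ hρ r x (by rwa [hn ρ hρ hfix]))
      (fun σ hσ => by
        obtain ⟨k, hk⟩ := exists_pow_smul_eq_zero_of_mem_support hf' (φ σ⁻¹ hσ.inv x)
        refine ⟨k, ?_⟩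
        have h := hsmul σ hσ (f ^ k) (φ σ⁻¹ hσ.inv x)
        rw [hk, map_zero, hinv, map_pow] at h
        exact h.symm)
    refine ⟨N, fun σ hσ => hpull σ⁻¹ hσ.inv _ _ ?_⟩
    rw [map_pow, hinv' σ hσ]
    exact hN σ⁻¹ hσ.inv
  choose N hN using hbound
  have hann : f ^ s.sup N ∈ (⊤ : Submodule (MvPolynomial ℕ A) M).annihilator := by
    rw [hs, Submodule.mem_annihilator_span]
    rintro ⟨_, x, hx, σ, hσ, rfl⟩
    obtain ⟨j, hj⟩ := Nat.exists_eq_add_of_le (Finset.le_sup (f := N) hx)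
    change f ^ s.sup N • φ σ hσ x = 0
    rw [hj, add_comm, pow_add, mul_smul, hN, smul_zero]
  exact q.2.mem_of_pow_mem _ (hq hann)

end
end
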